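/- arXiv:1611.08634 — 2 statements merged into one kernel-verified Lean document; each statement's English description precedes it below -/
import Mathlib

section
/- Let l ≥ 1 be an integer and 0 = a_0 < a_1 < … < a_l < a_{l+1} = 1 be real numbers. Let λ_0, …, λ_l be real numbers with λ_i ≠ λ_{i+1} for i = 0, …, l−1 and Σ_{i=0}^{l} (a_{i+1} − a_i) λ_i = 0. Define h : (0,1) → ℝ by h(x) = (Σ_{j=1}^{i} (a_j − a_{j−1}) λ_{j−1} + (x − a_i) λ_i) / √(x(1−x)) for x ∈ [a_i, a_{i+1}] ∩ (0,1), 0 ≤ i ≤ l. Then every point x* ∈ (0,1) at which |h| attains its supremum over (0,1) satisfies x* = a_i for some 1 ≤ i ≤ l; that is, the maximum of |h| can only be attained at one of the breakpoints a_1, …, a_l. -/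
theorem uh_aux (A B x u v : ℝ) (hx : x ∈ Set.Ioo (0 : ℝ) 1) (hu : u < x) (hv : x < v)
    (hmax : ∀ y ∈ Set.Ioo u v, y ∈ Set.Ioo (0 : ℝ) 1 →
      (A + B * y) ^ 2 / (y * (1 - y)) ≤ (A + B * x) ^ 2 / (x * (1 - x))) :
    A = 0 ∧ B = 0 := by
  obtain ⟨hx0, hx1⟩ := hx
  have hx1' : 0 < 1 - x := by linarith
  have c2 : ContinuousAt (fun s : ℝ => s * x / ((1 - x) + s * x)) 1 := by
    apply ContinuousAt.div (by fun_prop) (by fun_prop)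
    simp
  have c1 : ContinuousAt (fun s : ℝ => x / (s * (1 - x) + x)) 1 := by
    apply ContinuousAt.div (by fun_prop) (by fun_prop)
    simp
  have e2 : ∀ᶠ s in nhds (1 : ℝ), s * x / ((1 - x) + s * x) ∈ Set.Ioo u v := by
    apply c2.eventually_mem
    simpa using Ioo_mem_nhds hu hv
  have e1 : ∀ᶠ s in nhds (1 : ℝ), x / (s * (1 - x) + x) ∈ Set.Ioo u v := by
    apply c1.eventually_mem
    simpa using Ioo_mem_nhds hu hv
  obtain ⟨s, ⟨hs1, hs2⟩, hs⟩ := (((e1.and e2).filter_mono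
    (nhdsWithin_le_nhds (s := Set.Ioi 1))).and self_mem_nhdsWithin).exists
  have hs : 1 < s := hs
  have hs0 : 0 < s := by linarith
  have hd1 : 0 < s * (1 - x) + x := by positivity
  have hd2 : 0 < (1 - x) + s * x := by positivity
  have m1 := hmax _ hs1 ⟨by positivity, by
    rw [div_lt_one hd1]; nlinarith [mul_pos hs0 hx1']⟩
  have m2 := hmax _ hs2 ⟨by positivity, by
    rw [div_lt_one hd2]; linarith⟩
  have hxne : x ≠ 0 := hx0.ne'
  have hxne' : 1 - x ≠ 0 := hx1'.ne'
  have key : ∀ y : ℝ, y ≠ 0 → 1 - y ≠ 0 → (A + B * y) ^ 2 / (y * (1 - y))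
      = A ^ 2 * ((1 - y) / y) + (A + B) ^ 2 * (y / (1 - y)) + 2 * A * (A + B) := by
    intro y h1 h2
    field_simp
    ring
  have f1 : 1 - x / (s * (1 - x) + x) = s * (1 - x) / (s * (1 - x) + x) := by
    field_simp
    ring
  have f2 : 1 - s * x / ((1 - x) + s * x) = (1 - x) / ((1 - x) + s * x) := by
    field_simp
    ring
  rw [key x hxne hxne', key _ (by positivity) (by rw [f1]; positivity), f1] at m1
  rw [key x hxne hxne', key _ (by positivity) (by rw [f2]; positivity), f2] at m2
  rw [div_div_div_cancel_right₀ hd1.ne', div_div_div_cancel_right₀ hd1.ne'] at m1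
  rw [div_div_div_cancel_right₀ hd2.ne', div_div_div_cancel_right₀ hd2.ne'] at m2
  set t := x / (1 - x) with ht
  have ht0 : 0 < t := by positivity
  have g1 : (1 - x) / x = 1 / t := by rw [ht]; field_simp
  have g2 : s * (1 - x) / x = s / t := by rw [ht]; field_simp
  have g3 : x / (s * (1 - x)) = t / s := by rw [ht]; field_simp
  have g4 : (1 - x) / (s * x) = 1 / (s * t) := by rw [ht]; field_simp
  have g5 : s * x / (1 - x) = s * t := by rw [ht]; field_simp
  rw [g1, g2, g3] at m1
  rw [g1, g4, g5] at m2
  have hw : 0 < s + 1 / s - 2 := by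
    have : s + 1 / s - 2 = (s - 1) ^ 2 / s := by field_simp; ring
    rw [this]
    have : 0 < s - 1 := by linarith
    positivity
  have hsum : (A ^ 2 * (1 / t) + (A + B) ^ 2 * t) * (s + 1 / s - 2) ≤ 0 := by
    have : (A ^ 2 * (1 / t) + (A + B) ^ 2 * t) * (s + 1 / s - 2)
      = (A ^ 2 * (s / t) + (A + B) ^ 2 * (t / s)) + (A ^ 2 * (1 / (s * t)) + (A + B) ^ 2 * (s * t))
        - 2 * (A ^ 2 * (1 / t) + (A + B) ^ 2 * t) := by
      field_simp
      ring
    linarith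
  have hle : A ^ 2 * (1 / t) + (A + B) ^ 2 * t ≤ 0 := by
    by_contra hc
    push Not at hc
    linarith [mul_pos hc hw]
  have n1 : 0 ≤ A ^ 2 * (1 / t) := by positivity
  have n2 : 0 ≤ (A + B) ^ 2 * t := by positivity
  have z1 : A ^ 2 * (1 / t) = 0 := by linarith
  have z2 : (A + B) ^ 2 * t = 0 := by linarith
  have hA : A = 0 := by
    simpa [ht0.ne'] using z1
  have hB : A + B = 0 := by
    simpa [ht0.ne'] using z2
  exact ⟨hA, by linarith⟩

/-- Lemma 1 (Venkatraman 1993, Lemma 2.2): for a zero-mean piecewise constant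
function with breakpoints `a 1 < ... < a l` in `(0,1)`, the function
`h x = (∑_{j=1}^i (a j - a (j-1)) * λ (j-1) + (x - a i) * λ i) / √(x(1-x))`
(for `x ∈ [a i, a (i+1)]`) can attain the maximum of `|h|` over `(0,1)`
only at one of the breakpoints `a 1, ..., a l`. -/
theorem uh_locating_max_only_at_breakpoints
    (l : ℕ) (hl : 1 ≤ l) (a lam : ℕ → ℝ)
    (ha0 : a 0 = 0) (ha_last : a (l + 1) = 1)
    (ha_mono : ∀ i ≤ l, a i < a (i + 1))
    (hlam : ∀ i < l, lam i ≠ lam (i + 1))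
    (hzero : ∑ i ∈ Finset.range (l + 1), (a (i + 1) - a i) * lam i = 0)
    (h : ℝ → ℝ)
    (hh : ∀ i ≤ l, ∀ x ∈ Set.Icc (a i) (a (i + 1)), x ∈ Set.Ioo (0 : ℝ) 1 →
      h x = (∑ j ∈ Finset.range i, (a (j + 1) - a j) * lam j + (x - a i) * lam i)
        / Real.sqrt (x * (1 - x))) :
    ∀ x ∈ Set.Ioo (0 : ℝ) 1,
      (∀ y ∈ Set.Ioo (0 : ℝ) 1, |h y| ≤ |h x|) →
      ∃ i, 1 ≤ i ∧ i ≤ l ∧ x = a i := by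
  intro x hx hmax
  have hex : ∃ n, x < a n := ⟨l + 1, by rw [ha_last]; exact hx.2⟩
  classical
  obtain ⟨i, hi⟩ : ∃ i, Nat.find hex = i + 1 := by
    refine Nat.exists_eq_succ_of_ne_zero ?_
    intro h0
    have := Nat.find_spec hex
    rw [h0, ha0] at this
    linarith [hx.1]
  have hlt : x < a (i + 1) := hi ▸ Nat.find_spec hex
  have hge : a i ≤ x := not_lt.1 (Nat.find_min hex (by omega))
  have hil : i ≤ l := by
    have : Nat.find hex ≤ l + 1 := Nat.find_min' hex (by rw [ha_last]; exact hx.2)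
    omega
  rcases hge.eq_or_lt with heq | hgt
  · refine ⟨i, ?_, hil, heq.symm⟩
    rcases Nat.eq_zero_or_pos i with h0 | h0
    · subst h0
      linarith [hx.1]
    · exact h0
  exfalso
  set S := ∑ j ∈ Finset.range i, (a (j + 1) - a j) * lam j with hS
  have hform : ∀ y ∈ Set.Ioo (a i) (a (i + 1)), y ∈ Set.Ioo (0 : ℝ) 1 →
      |h y| ^ 2 = ((S - a i * lam i) + lam i * y) ^ 2 / (y * (1 - y)) := by
    intro y hy hy01
    rw [sq_abs, hh i hil y (Set.Ioo_subset_Icc_self hy) hy01, div_pow, Real.sq_sqrt]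
    · congr 2
      ring
    · exact mul_nonneg hy01.1.le (by linarith [hy01.2])
  have hz := uh_aux (S - a i * lam i) (lam i) x (a i) (a (i + 1)) hx hgt hlt (by
    intro y hy hy01
    rw [← hform y hy hy01, ← hform x ⟨hgt, hlt⟩ hx]
    have := hmax y hy01
    gcongr)
  have hx0 : |h x| = 0 := by
    have := hform x ⟨hgt, hlt⟩ hx
    rw [hz.1, hz.2] at this
    simpa using this
  have hall : ∀ y ∈ Set.Ioo (0 : ℝ) 1, h y = 0 := by
    intro y hy
    have := hmax y hy
    rw [hx0] at this
    exact abs_nonpos_iff.1 this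
  have hle1 : ∀ k, ∀ m, m + k = l + 1 → a m ≤ 1 := by
    intro k
    induction k with
    | zero => intro m hm; rw [show m = l + 1 by omega, ha_last]
    | succ k ih =>
      intro m hm
      exact (ha_mono m (by omega)).le.trans (ih (m + 1) (by omega))
  have h01 := ha_mono 0 (by omega)
  have h12 := ha_mono 1 hl
  have h2 : a 2 ≤ 1 := hle1 (l - 1) 2 (by omega)
  simp only [zero_add, ha0, one_add_one_eq_two] at h01 h12
  have key : ∀ y ∈ Set.Ioo (0 : ℝ) 1, Real.sqrt (y * (1 - y)) ≠ 0 := by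
    intro y hy
    exact (Real.sqrt_pos.2 (mul_pos hy.1 (by linarith [hy.2]))).ne'
  have l0 : lam 0 = 0 := by
    have hm : a 1 ∈ Set.Ioo (0 : ℝ) 1 := ⟨h01, by linarith⟩
    have := hh 0 (by omega) (a 1) ⟨by rw [ha0]; exact h01.le, le_refl _⟩ hm
    rw [hall _ hm, eq_comm, div_eq_zero_iff, or_iff_left (key _ hm)] at this
    simpa [ha0, h01.ne'] using this
  have l1 : lam 1 = 0 := by
    have hm : (a 1 + a 2) / 2 ∈ Set.Ioo (0 : ℝ) 1 := ⟨by linarith, by linarith⟩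
    have := hh 1 hl ((a 1 + a 2) / 2)
      ⟨by linarith, by rw [one_add_one_eq_two]; linarith⟩ hm
    rw [hall _ hm, eq_comm, div_eq_zero_iff, or_iff_left (key _ hm)] at this
    simp only [Finset.sum_range_one, l0, mul_zero, zero_add, mul_eq_zero] at this
    rcases this with h' | h'
    · linarith
    · exact h'
  exact hlam 0 (by omega) (by rw [l0, zero_add, l1])
end

section
/- Let n, A, h, Δ, p be real numbers with n > 0, A > 0, h > 0 and 0 < Δ ≤ p ≤ 1/4. Define c_0 = √(2A/(Δn)), c_{1/2} = √(2A/n), c_1 = √(A/(2n)), and C_0 = (h√p − √(2pA/(Δn)))², C_{1/2} = (h√p − √(2A/n))², C_1 = (h√p − √(A/(2pn)))². Assume c_0 ≤ h and c_1 ≤ h·p. Then C_{1/2} ≥ C_0 and C_{1/2} ≥ C_1; that is, with the type-1-error-calibrated critical values, the exponent governing the rate of convergence of the type 2 error probability is largest for δ = 1/2. -/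
/-- With the type-1-error-calibrated critical values
`c_0 = √(2A/(Δn))`, `c_{1/2} = √(2A/n)`, `c_1 = √(A/(2n))`, the exponents
`C_δ = (h p^δ − c_δ)²/p^{2δ−1}` governing the rate of convergence of the
type 2 error probability satisfy `C_{1/2} ≥ C_0` and `C_{1/2} ≥ C_1`;
that is, the rate is best for `δ = 1/2`. -/
theorem brodsky_exponent_half_best (n A h Δ p : ℝ)
    (hn : 0 < n) (hA : 0 < A) (hh : 0 < h)
    (hΔ : 0 < Δ) (hΔp : Δ ≤ p) (hp : p ≤ 1 / 4)
    (c0 chalf c1 C0 Chalf C1 : ℝ)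
    (hc0 : c0 = Real.sqrt (2 * A / (Δ * n)))
    (hchalf : chalf = Real.sqrt (2 * A / n))
    (hc1 : c1 = Real.sqrt (A / (2 * n)))
    (hC0 : C0 = (h * Real.sqrt p - Real.sqrt (2 * p * A / (Δ * n))) ^ 2)
    (hChalf : Chalf = (h * Real.sqrt p - Real.sqrt (2 * A / n)) ^ 2)
    (hC1 : C1 = (h * Real.sqrt p - Real.sqrt (A / (2 * p * n))) ^ 2)
    (hc0h : c0 ≤ h) (hc1hp : c1 ≤ h * p) :
    Chalf ≥ C0 ∧ Chalf ≥ C1 := by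
  have hp0 : 0 < p := lt_of_lt_of_le hΔ hΔp
  have e : h * Real.sqrt p = Real.sqrt (h ^ 2 * p) := by
    rw [Real.sqrt_mul (by positivity), Real.sqrt_sq hh.le]
  have k0 : 2 * A / (Δ * n) ≤ h ^ 2 := by
    rw [hc0] at hc0h
    exact (Real.sqrt_le_left hh.le).1 hc0h
  have k1 : A / (2 * n) ≤ (h * p) ^ 2 := by
    rw [hc1] at hc1hp
    exact (Real.sqrt_le_left (by positivity)).1 hc1hp
  have a0 : Real.sqrt (2 * p * A / (Δ * n)) ≤ h * Real.sqrt p := by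
    rw [e]
    apply Real.sqrt_le_sqrt
    calc 2 * p * A / (Δ * n) = 2 * A / (Δ * n) * p := by ring
      _ ≤ h ^ 2 * p := by gcongr
  have a1 : Real.sqrt (A / (2 * p * n)) ≤ h * Real.sqrt p := by
    rw [e]
    apply Real.sqrt_le_sqrt
    calc A / (2 * p * n) = A / (2 * n) / p := by field_simp
      _ ≤ (h * p) ^ 2 / p := by gcongr
      _ = h ^ 2 * p := by field_simp
  have b0 : Real.sqrt (2 * A / n) ≤ Real.sqrt (2 * p * A / (Δ * n)) := by
    apply Real.sqrt_le_sqrt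
    rw [div_le_div_iff₀ hn (by positivity)]
    have : 0 ≤ (p - Δ) * (A * n) := mul_nonneg (by linarith) (by positivity)
    nlinarith
  have b1 : Real.sqrt (2 * A / n) ≤ Real.sqrt (A / (2 * p * n)) := by
    apply Real.sqrt_le_sqrt
    rw [div_le_div_iff₀ hn (by positivity)]
    have : 0 ≤ (1 / 4 - p) * (A * n) := mul_nonneg (by linarith) (by positivity)
    nlinarith
  subst hC0 hChalf hC1
  exact ⟨pow_le_pow_left₀ (by linarith) (by linarith) 2,
    pow_le_pow_left₀ (by linarith) (by linarith) 2⟩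
end
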